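/- Let f₁,…,fₙ : ℝ^d → ℝ be differentiable with each f_i L_i-smooth and μ_i-strongly convex (μ_i > 0), let α > 0, let x_i be the minimizer of f_i, define f̃(x) = (1/n)∑_{i=1}^n f_i(α x + (1−α)x_i), let x* be a global minimizer of f̃, and let μ̄ = (1/n)∑_{i=1}^n μ_i. Then (1/n)∑_{i=1}^n ‖x_i − x*‖² ≤ (max_i L_i / μ̄) · max_{i,j} ‖x_i − x_j‖². -/

import Mathlib

open scoped RealInnerProductSpace

/-- `g` is `L`-smooth: its gradient is `L`-Lipschitz. -/
def LSmooth {d : ℕ} (L : ℝ) (g : EuclideanSpace ℝ (Fin d) → ℝ) : Prop :=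
  ∀ x y, ‖gradient g x - gradient g y‖ ≤ L * ‖x - y‖

/-- `g` is `μ`-strongly convex. -/
def StrongConvexWith {d : ℕ} (μ : ℝ) (g : EuclideanSpace ℝ (Fin d) → ℝ) : Prop :=
  ∀ x y, g y + ⟪gradient g y, x - y⟫ + μ / 2 * ‖x - y‖ ^ 2 ≤ g x

/-- The descent lemma: an `L`-smooth function lies below its quadratic upper model. -/
theorem LSmooth.le_quadratic {d : ℕ} {L : ℝ} {g : EuclideanSpace ℝ (Fin d) → ℝ}
    (hg : Differentiable ℝ g) (hL : LSmooth L g) (x y : EuclideanSpace ℝ (Fin d)) :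
    g y ≤ g x + ⟪gradient g x, y - x⟫ + L / 2 * ‖y - x‖ ^ 2 := by
  set v := y - x with hv
  let h : ℝ → ℝ := fun t ↦ t * ⟪gradient g x, v⟫ + L / 2 * ‖v‖ ^ 2 * t ^ 2 - g (x + t • v)
  have hderiv (t : ℝ) : HasDerivAt h
      (⟪gradient g x, v⟫ + L * ‖v‖ ^ 2 * t - ⟪gradient g (x + t • v), v⟫) t := by
    have hline : HasDerivAt (fun t : ℝ ↦ x + t • v) v t := by
      simpa using ((hasDerivAt_id t).smul_const v).const_add x
    have hcomp := (hg (x + t • v)).hasGradientAt.hasFDerivAt.comp_hasDerivAt t hline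
    rw [InnerProductSpace.toDual_apply_apply] at hcomp
    have hpoly := ((hasDerivAt_id t).mul_const ⟪gradient g x, v⟫).add
      (((hasDerivAt_id t).pow 2).const_mul (L / 2 * ‖v‖ ^ 2))
    refine (hpoly.sub hcomp).congr_deriv ?_
    simp only [id]
    push_cast
    ring
  have hmono : MonotoneOn h (Set.Icc 0 1) := by
    refine monotoneOn_of_deriv_nonneg (convex_Icc 0 1)
      (fun t _ ↦ (hderiv t).continuousAt.continuousWithinAt)
      (fun t _ ↦ (hderiv t).differentiableAt.differentiableWithinAt) fun t ht ↦ ?_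
    rw [interior_Icc] at ht
    rw [(hderiv t).deriv]
    have hcs := real_inner_le_norm (gradient g (x + t • v) - gradient g x) v
    have hlip := mul_le_mul_of_nonneg_right (hL (x + t • v) x) (norm_nonneg v)
    rw [add_sub_cancel_left, norm_smul, Real.norm_of_nonneg ht.1.le] at hlip
    rw [inner_sub_left] at hcs
    linarith
  have h01 := hmono (Set.left_mem_Icc.2 zero_le_one) (Set.right_mem_Icc.2 zero_le_one) zero_le_one
  have hy : x + v = y := by simp [hv]
  simp only [h, zero_smul, one_smul, add_zero, hy] at h01
  linarith

theorem gradient_eq_zero_of_forall_le {d : ℕ} {g : EuclideanSpace ℝ (Fin d) → ℝ}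
    {x : EuclideanSpace ℝ (Fin d)} (hx : ∀ y, g x ≤ g y) : gradient g x = 0 := by
  have hmin : IsLocalMin g x := Filter.Eventually.of_forall hx
  simp [gradient, hmin.fderiv_eq_zero]

/-- First-order optimality for the FLIX objective. -/
theorem sum_inner_gradient_eq_zero {d n : ℕ} {f : Fin n → EuclideanSpace ℝ (Fin d) → ℝ}
    (hdiff : ∀ i, Differentiable ℝ (f i)) {α : ℝ} (hα : α ≠ 0)
    {b : Fin n → EuclideanSpace ℝ (Fin d)} {x : EuclideanSpace ℝ (Fin d)}
    (hx : ∀ y, ∑ i, f i (α • x + b i) ≤ ∑ i, f i (α • y + b i))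
    (v : EuclideanSpace ℝ (Fin d)) :
    ∑ i, ⟪gradient (f i) (α • x + b i), v⟫ = 0 := by
  have hderiv : HasDerivAt (fun t : ℝ ↦ ∑ i, f i (α • (x + t • v) + b i))
      (∑ i, ⟪gradient (f i) (α • x + b i), α • v⟫) 0 := by
    refine HasDerivAt.fun_sum fun i _ ↦ ?_
    have hline : HasDerivAt (fun t : ℝ ↦ α • (x + t • v) + b i) (α • v) 0 := by
      simpa using ((((hasDerivAt_id (0 : ℝ)).smul_const v).const_add x).const_smul α).add_const (b i)
    have hgrad := (hdiff i (α • (x + (0 : ℝ) • v) + b i)).hasGradientAt.hasFDerivAt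
    have hcomp := hgrad.comp_hasDerivAt 0 hline
    rw [InnerProductSpace.toDual_apply_apply] at hcomp
    simpa [Function.comp_def] using hcomp
  have hmin : IsLocalMin (fun t : ℝ ↦ ∑ i, f i (α • (x + t • v) + b i)) 0 :=
    Filter.Eventually.of_forall fun t ↦ by simpa using hx (x + t • v)
  have hzero := hmin.hasDerivAt_eq_zero hderiv
  simp only [inner_smul_right, ← Finset.mul_sum] at hzero
  exact (mul_eq_zero.1 hzero).resolve_left hα

/-- A smoothness constant may be negative only on the trivial space, where all distances vanish. -/
theorem LSmooth.mul_sq_le_mul {d : ℕ} {L M D : ℝ} {g : EuclideanSpace ℝ (Fin d) → ℝ}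
    (hL : LSmooth L g) (hLM : L ≤ M) {x y : EuclideanSpace ℝ (Fin d)}
    (hD : ‖x - y‖ ^ 2 ≤ D) (hD0 : Subsingleton (EuclideanSpace ℝ (Fin d)) → D = 0) :
    L * ‖x - y‖ ^ 2 ≤ M * D := by
  by_cases hM : 0 ≤ M
  · exact (mul_le_mul_of_nonneg_right hLM (sq_nonneg _)).trans (mul_le_mul_of_nonneg_left hD hM)
  · have hsub : Subsingleton (EuclideanSpace ℝ (Fin d)) := by
      refine ⟨fun a b ↦ ?_⟩
      have h := (norm_nonneg _).trans (hL a b)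
      have hab : ‖a - b‖ ≤ 0 := by
        by_contra! hpos
        nlinarith
      exact sub_eq_zero.1 (norm_le_zero_iff.1 hab)
    simp [Subsingleton.elim x y, hD0 hsub]

/-- the average squared distance of the local minimizers to the FLIX
minimizer is bounded via the diameter of the local minimizers. -/
theorem average_distance_bound {d n : ℕ} (hn : 0 < n)
    (f : Fin n → EuclideanSpace ℝ (Fin d) → ℝ)
    (hdiff : ∀ i, Differentiable ℝ (f i))
    (L μ : Fin n → ℝ) (hμpos : ∀ i, 0 < μ i)
    (hsmooth : ∀ i, LSmooth (L i) (f i))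
    (hsc : ∀ i, StrongConvexWith (μ i) (f i))
    (α : ℝ) (hα : 0 < α)
    (xs : Fin n → EuclideanSpace ℝ (Fin d))
    (hxs : ∀ i y, f i (xs i) ≤ f i y)
    (ftilde : EuclideanSpace ℝ (Fin d) → ℝ)
    (hft : ftilde = fun x => (1 / n : ℝ) * ∑ i, f i (α • x + (1 - α) • xs i))
    (xstar : EuclideanSpace ℝ (Fin d)) (hxstar : ∀ y, ftilde xstar ≤ ftilde y)
    (μbar : ℝ) (hμbar : μbar = (1 / n : ℝ) * ∑ i, μ i) :
    (1 / n : ℝ) * ∑ i, ‖xs i - xstar‖ ^ 2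
      ≤ ((⨆ i, L i) / μbar) * ⨆ i, ⨆ j, ‖xs i - xs j‖ ^ 2 := by
  have hn' : (0 : ℝ) < n := by exact_mod_cast hn
  have : Nonempty (Fin n) := ⟨⟨0, hn⟩⟩
  have hμsum : 0 < ∑ i, μ i := Finset.sum_pos (fun i _ ↦ hμpos i) Finset.univ_nonempty
  have hμbar_pos : 0 < μbar := by rw [hμbar]; positivity
  have hsum : (n : ℝ) * μbar = ∑ i, μ i := by rw [hμbar]; field_simp
  set M := ⨆ i, L i
  set D := ⨆ i, ⨆ j, ‖xs i - xs j‖ ^ 2 with hDdef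
  have hLM (i) : L i ≤ M := le_ciSup (Set.finite_range L).bddAbove i
  have hD (i j) : ‖xs i - xs j‖ ^ 2 ≤ D :=
    (le_ciSup (f := fun j ↦ ‖xs i - xs j‖ ^ 2) (Set.finite_range _).bddAbove j).trans
      (le_ciSup (f := fun i ↦ ⨆ j, ‖xs i - xs j‖ ^ 2) (Set.finite_range _).bddAbove i)
  have hD0 (hsub : Subsingleton (EuclideanSpace ℝ (Fin d))) : D = 0 := by
    have h (i j) : xs i - xs j = 0 := Subsingleton.elim _ _
    simp [hDdef, h]
  have hmin (y) : ∑ i, f i (α • xstar + (1 - α) • xs i) ≤ ∑ i, f i (α • y + (1 - α) • xs i) := by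
    have h := hxstar y
    rw [hft] at h
    exact le_of_mul_le_mul_left h (by positivity)
  have hdist (j) : ‖xs j - xstar‖ ^ 2 ≤ M / μbar * D := by
    have hlower (i) : f i (xs i) + α * ⟪gradient (f i) (α • xstar + (1 - α) • xs i), xs j - xstar⟫
        + μ i * (α ^ 2 / 2 * ‖xs j - xstar‖ ^ 2) ≤ f i (α • xs j + (1 - α) • xs i) := by
      have h := hsc i (α • xs j + (1 - α) • xs i) (α • xstar + (1 - α) • xs i)
      have hd : α • xs j + (1 - α) • xs i - (α • xstar + (1 - α) • xs i) = α • (xs j - xstar) := by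
        module
      rw [hd, inner_smul_right, norm_smul, mul_pow, Real.norm_eq_abs, sq_abs] at h
      linarith [hxs i (α • xstar + (1 - α) • xs i)]
    have hupper (i) : f i (α • xs j + (1 - α) • xs i) ≤ f i (xs i) + α ^ 2 / 2 * (M * D) := by
      have h := (hsmooth i).le_quadratic (hdiff i) (xs i) (α • xs j + (1 - α) • xs i)
      have hd : α • xs j + (1 - α) • xs i - xs i = α • (xs j - xs i) := by module
      rw [gradient_eq_zero_of_forall_le (hxs i), inner_zero_left, hd, norm_smul, mul_pow,
        Real.norm_eq_abs, sq_abs] at h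
      have hLD := mul_le_mul_of_nonneg_left
        ((hsmooth i).mul_sq_le_mul (hLM i) (hD j i) hD0) (by positivity : 0 ≤ α ^ 2 / 2)
      linarith
    have htotal := Finset.sum_le_sum fun i (_ : i ∈ Finset.univ) ↦ (hlower i).trans (hupper i)
    simp only [Finset.sum_add_distrib, ← Finset.mul_sum, ← Finset.sum_mul,
      sum_inner_gradient_eq_zero hdiff hα.ne' hmin, Finset.sum_const, Finset.card_univ,
      Fintype.card_fin, nsmul_eq_mul, ← hsum] at htotal
    have hscaled : n * (α ^ 2 / 2) * (μbar * ‖xs j - xstar‖ ^ 2) ≤ n * (α ^ 2 / 2) * (M * D) := by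
      linarith
    have := le_of_mul_le_mul_left hscaled (by positivity)
    rw [div_mul_eq_mul_div, le_div_iff₀ hμbar_pos]
    linarith
  calc (1 / n : ℝ) * ∑ i, ‖xs i - xstar‖ ^ 2
      ≤ (1 / n : ℝ) * ∑ _i : Fin n, M / μbar * D := by gcongr with i; exact hdist i
    _ = M / μbar * D := by
      rw [Finset.sum_const, Finset.card_univ, Fintype.card_fin, nsmul_eq_mul]
      field_simp
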